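/- arXiv:2507.17949 — 2 statements merged into one kernel-verified Lean document; each statement's English description precedes it below -/
import Mathlib

section
/- If f = 1 + ∑_{n≥1} a(n)q^n is a modular form of weight 12 for SL₂(ℤ) with a(1) ≥ 0 and a(2) ≥ 0, then a(n) ≥ 0 for all n; moreover a(n) > 0 for all n ≥ 3. Consequently A(12) = 2, witnessed by the form F₁₂,₀ + 8191·Δ whose only negative coefficient is the coefficient of q². -/
open Real Complex UpperHalfPlane MatrixGroups CongruenceSubgroup

namespace ModularForm

open EisensteinSeries

lemma norm_tprod_one_sub_pow_le {q : ℂ} (hq : ‖q‖ < 1) :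
    ‖∏' n : ℕ, (1 - q ^ (n + 1))‖ ≤ Real.exp (‖q‖ / (1 - ‖q‖)) := by
  have hs : HasSum (fun n : ℕ ↦ ‖q‖ ^ (n + 1)) (‖q‖ / (1 - ‖q‖)) := by
    simpa [pow_succ', div_eq_mul_inv] using
      (hasSum_geometric_of_lt_one (norm_nonneg q) hq).mul_left ‖q‖
  refine le_of_tendsto (multipliable_one_sub_pow hq).hasProd.norm (.of_forall fun s ↦ ?_)
  rw [← norm_prod]
  calc ‖∏ n ∈ s, (1 - q ^ (n + 1))‖ ≤ ∏ n ∈ s, Real.exp (‖q‖ ^ (n + 1)) := by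
        rw [norm_prod]
        refine Finset.prod_le_prod (fun _ _ ↦ norm_nonneg _) fun n _ ↦ ?_
        calc ‖1 - q ^ (n + 1)‖ ≤ ‖q‖ ^ (n + 1) + 1 := by
              simpa [add_comm] using norm_sub_le (1 : ℂ) (q ^ (n + 1))
          _ ≤ _ := Real.add_one_le_exp _
    _ ≤ _ := by
        rw [← Real.exp_sum]
        gcongr
        exact sum_le_hasSum s (fun _ _ ↦ by positivity) hs

lemma norm_discriminant_le {z : ℍ} (hz : 3 ≤ 4 * z.im ^ 2) :
    ‖discriminant z‖ ≤ 2 * Real.exp (-2 * π * z.im) := by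
  have hnorm : ‖Function.Periodic.qParam 1 (z : ℂ)‖ = Real.exp (-2 * π * z.im) := by
    simp [Function.Periodic.qParam, Complex.norm_exp]
  set q := Function.Periodic.qParam 1 (z : ℂ)
  have hq : ‖q‖ ≤ 1 / 100 := by
    have him : 5 / 6 < z.im := by nlinarith [z.im_pos]
    rw [hnorm, show -2 * π * z.im = -(2 * π * z.im) by ring, Real.exp_neg, one_div]
    refine inv_anti₀ (by norm_num) ?_
    calc (100 : ℝ) ≤ 2.7 ^ 5 := by norm_num
      _ ≤ Real.exp 1 ^ 5 := by gcongr; linarith [Real.exp_one_gt_d9]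
      _ = Real.exp 5 := by rw [← Real.exp_nat_mul]; norm_num
      _ ≤ _ := by rw [Real.exp_le_exp]; nlinarith [Real.pi_gt_three]
  have hprod : discriminant z = q * (∏' n : ℕ, (1 - q ^ (n + 1))) ^ 24 := by
    rw [discriminant_eq_q_prod, ← (multipliable_one_sub_pow (by linarith)).tprod_pow]
  rw [hprod, norm_mul, norm_pow, mul_comm, ← hnorm]
  gcongr
  calc _ ≤ Real.exp (‖q‖ / (1 - ‖q‖)) ^ 24 := by
        gcongr; exact norm_tprod_one_sub_pow_le (by linarith)
    _ ≤ Real.exp (1 / 99) ^ 24 := by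
        refine pow_le_pow_left₀ (Real.exp_pos _).le (Real.exp_le_exp.mpr ?_) 24
        rw [div_le_div_iff₀ (by linarith) (by norm_num)]
        linarith
    _ = Real.exp (24 / 99) := by rw [← Real.exp_nat_mul]; norm_num
    _ ≤ Real.exp (Real.log 2) := by rw [Real.exp_le_exp]; linarith [Real.log_two_gt_d9]
    _ = 2 := Real.exp_log (by norm_num)

lemma norm_discriminant_mul_im_pow_smul (γ : SL(2, ℤ)) (z : ℍ) :
    ‖discriminant (γ • z)‖ * (γ • z).im ^ 6 = ‖discriminant z‖ * z.im ^ 6 := by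
  have h := congrArg norm (petersson_slash_SL 12 discriminant discriminant γ z)
  rw [SlashInvariantForm.slash_action_generators_SL2Z discriminant_S_invariant
    discriminant_T_invariant] at h
  have key (w : ℍ) : ‖petersson 12 discriminant discriminant w‖ =
      (‖discriminant w‖ * w.im ^ 6) ^ 2 := by
    simp only [petersson, norm_mul, RCLike.norm_conj, norm_zpow, Complex.norm_real, Real.norm_eq_abs,
      abs_of_pos w.im_pos]
    norm_cast
    ring
  have pos (w : ℍ) : 0 ≤ ‖discriminant w‖ * w.im ^ 6 :=
    mul_nonneg (norm_nonneg _) (pow_nonneg w.im_pos.le 6)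
  rw [key, key] at h
  exact ((pow_left_inj₀ (pos _) (pos _) two_ne_zero).mp h).symm

lemma norm_discriminant_mul_im_pow_le (z : ℍ) :
    ‖discriminant z‖ * z.im ^ 6 ≤ 2 * ((3 / π) ^ 6 * Real.exp (-6)) := by
  obtain ⟨γ, hγ⟩ := ModularGroup.exists_smul_mem_fd z
  rw [← norm_discriminant_mul_im_pow_smul γ z]
  set w := γ • z
  have hw : w.im ≤ 3 / π * Real.exp (π * w.im / 3 - 1) := by
    calc w.im = 3 / π * (π * w.im / 3) := by field_simp
      _ ≤ _ := by
        gcongr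
        linarith [Real.add_one_le_exp (π * w.im / 3 - 1)]
  calc _ ≤ 2 * Real.exp (-2 * π * w.im) * (3 / π * Real.exp (π * w.im / 3 - 1)) ^ 6 := by
        have := w.im_pos
        gcongr
        exact norm_discriminant_le (ModularGroup.three_le_four_mul_im_sq_of_mem_fd hγ)
    _ = 2 * ((3 / π) ^ 6 * (Real.exp (-2 * π * w.im) * Real.exp (π * w.im / 3 - 1) ^ 6)) := by ring
    _ = _ := by
        rw [← Real.exp_nat_mul, ← Real.exp_add]
        congr 3
        push_cast
        ring

/-- Hecke's bound for the Ramanujan tau function, with an explicit constant. -/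
lemma norm_discriminant_qExpansion_coeff_le {n : ℕ} (hn : 1 ≤ n) :
    ‖(qExpansion 1 discriminant).coeff n‖ ≤ 2 * (n : ℝ) ^ 6 := by
  have hn' : (0 : ℝ) < n := by exact_mod_cast hn
  obtain ⟨t, ht_eq⟩ : ∃ t, t = 3 / (π * n) := ⟨_, rfl⟩
  have ht : 0 < t := by rw [ht_eq]; positivity
  have h := ModularFormClass.qExpansion_coeff_eq_intervalIntegral CuspForm.discriminant one_pos
    one_mem_strictPeriods_SL n ht
  rw [CuspForm.coe_discriminant] at h
  rw [h, ofReal_one, div_one, one_mul]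
  refine (intervalIntegral.norm_integral_le_of_norm_le_const (C := 2 * (n : ℝ) ^ 6)
    fun u _ ↦ ?_).trans (by simp)
  set z : ℍ := ⟨u + t * Complex.I, by simpa using ht⟩ with hz
  have him : z.im = t := by simp [hz, UpperHalfPlane.im]
  have hq : ‖Function.Periodic.qParam 1 (u + t * Complex.I)‖ ^ n = Real.exp (-6) := by
    rw [show (u + t * Complex.I : ℂ) = z from rfl, Function.Periodic.norm_qParam,
      ← Real.exp_nat_mul, UpperHalfPlane.coe_im, him, ht_eq]
    congr 1
    field_simp
    norm_num
  have hb := norm_discriminant_mul_im_pow_le z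
  rw [norm_mul, norm_div, norm_one, norm_pow, hq, one_div_mul_eq_div, div_le_iff₀ (Real.exp_pos _)]
  rw [him, ← le_div_iff₀ (by positivity)] at hb
  refine hb.trans_eq ?_
  rw [ht_eq]
  field_simp

lemma qExpansion_discriminant : (1728 : ℂ) • qExpansion 1 discriminant =
    qExpansion 1 E₄ ^ 3 - qExpansion 1 E₆ ^ 2 := by
  have h : (1728 : ℂ) • discriminant = ⇑(E₄.pow 3) - ⇑(E₆.pow 2) := by
    ext z
    rw [Pi.sub_apply, coe_pow, coe_pow, Pi.smul_apply, discriminant_eq_E₄_cube_sub_E₆_sq]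
    simp [mul_div_cancel₀]
  have hΔ := ModularForm.qExpansion_smul one_pos one_mem_strictPeriods_SL 1728 CuspForm.discriminant
  rw [CuspForm.coe_discriminant] at hΔ
  rw [← hΔ, h, ModularForm.qExpansion_sub one_pos one_mem_strictPeriods_SL (E₄.pow 3) (E₆.pow 2),
    ModularForm.qExpansion_pow one_pos one_mem_strictPeriods_SL,
    ModularForm.qExpansion_pow one_pos one_mem_strictPeriods_SL]

lemma discriminant_qExpansion_coeff_two : (qExpansion 1 discriminant).coeff 2 = -24 := by
  have h := congrArg (PowerSeries.coeff 2) qExpansion_discriminant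
  have hσ : ArithmeticFunction.sigma 3 2 = 9 ∧ ArithmeticFunction.sigma 5 2 = 33 := by decide
  norm_num [pow_succ, PowerSeries.coeff_mul, Finset.Nat.antidiagonal_succ,
    E_qExpansion_coeff _ (show Even 4 from ⟨2, rfl⟩),
    E_qExpansion_coeff _ (show Even 6 from ⟨3, rfl⟩), -PowerSeries.coeff_zero_eq_constantCoeff,
    show bernoulli 4 = -1 / 30 by decide +kernel, show bernoulli 6 = 1 / 42 by decide +kernel,
    hσ] at h
  linear_combination h / 1728

lemma E_qExpansion_eq_map {k : ℕ} (hk : 3 ≤ k) (hk2 : Even k) :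
    ∃ P : PowerSeries ℝ, qExpansion 1 (E hk) = P.map Complex.ofRealHom := by
  refine ⟨.mk fun m ↦ if m = 0 then 1 else -(2 * k / bernoulli k : ℝ) *
    ArithmeticFunction.sigma (k - 1) m, ?_⟩
  ext m
  rw [E_qExpansion_coeff hk hk2]
  split_ifs <;> simp [*]

/-- The Ramanujan tau function, as a real-valued sequence. -/
noncomputable def tau (n : ℕ) : ℝ := ((qExpansion 1 discriminant).coeff n).re

lemma ofReal_tau (n : ℕ) : (tau n : ℂ) = (qExpansion 1 discriminant).coeff n := by
  obtain ⟨P, hP⟩ := E_qExpansion_eq_map (show 3 ≤ 4 by norm_num) ⟨2, rfl⟩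
  obtain ⟨Q, hQ⟩ := E_qExpansion_eq_map (show 3 ≤ 6 by norm_num) ⟨3, rfl⟩
  have h := congrArg (PowerSeries.coeff n) qExpansion_discriminant
  rw [hP, hQ, ← map_pow, ← map_pow, ← map_sub, PowerSeries.coeff_map, PowerSeries.coeff_smul,
    ofRealHom_eq_coe, smul_eq_mul] at h
  have h' : (qExpansion 1 discriminant).coeff n =
      (((P ^ 3 - Q ^ 2).coeff n / 1728 : ℝ) : ℂ) := by
    push_cast
    linear_combination h / 1728
  rw [tau, h', ofReal_re]

lemma tau_zero : tau 0 = 0 := by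
  simp only [tau, ← CuspForm.coe_discriminant,
    CuspFormClass.qExpansion_coeff_zero CuspForm.discriminant one_pos one_mem_strictPeriods_SL,
    zero_re]

lemma tau_one : tau 1 = 1 := by simp [tau, discriminant_qExpansion_coeff_one]

lemma tau_two : tau 2 = -24 := by simp [tau, discriminant_qExpansion_coeff_two]

lemma abs_tau_le {n : ℕ} (hn : 1 ≤ n) : |tau n| ≤ 2 * (n : ℝ) ^ 6 :=
  (abs_re_le_norm _).trans (norm_discriminant_qExpansion_coeff_le hn)

lemma E_twelve_qExpansion_coeff (n : ℕ) :
    (qExpansion 1 (E (show 3 ≤ 12 by norm_num))).coeff n =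
      if n = 0 then 1 else (65520 / 691 : ℂ) * ArithmeticFunction.sigma 11 n := by
  rw [E_qExpansion_coeff _ ⟨6, rfl⟩, show bernoulli 12 = -691 / 2730 by decide +kernel]
  norm_num

lemma qExpansion_E_twelve_add_smul_discriminant_coeff (c : ℂ) (n : ℕ) :
    (qExpansion 1 (E (show 3 ≤ 12 by norm_num) + c • (CuspForm.discriminant : ℍ → ℂ))).coeff n =
      (if n = 0 then 1 else (65520 / 691 : ℂ) * ArithmeticFunction.sigma 11 n) + c * tau n := by
  rw [← FunLike.coe_smul, ModularForm.qExpansion_add one_pos one_mem_strictPeriods_SL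
    (a := 12) (b := 12) (E (show 3 ≤ 12 by norm_num)) (c • CuspForm.discriminant),
    FunLike.coe_smul, ModularForm.qExpansion_smul one_pos one_mem_strictPeriods_SL, map_add,
    E_twelve_qExpansion_coeff, PowerSeries.coeff_smul, ofReal_tau, smul_eq_mul,
    CuspForm.coe_discriminant]

/-- The coefficients of the weight 12 form with expansion `1 + a₁ q + ⋯`, where
`a₁ = 65520 / 691 + c`, are positive from `q ^ 3` on when `c` is not too large. -/
lemma sigma_add_mul_tau_pos {c : ℝ} (hc : |c| ≤ 86 * (65520 / 691)) {n : ℕ} (hn : 3 ≤ n) :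
    0 < 65520 / 691 * (ArithmeticFunction.sigma 11 n : ℝ) + c * tau n := by
  have hn' : (3 : ℝ) ≤ n := by exact_mod_cast hn
  have hσ : (n : ℝ) ^ 11 ≤ ArithmeticFunction.sigma 11 n := by
    rw [ArithmeticFunction.sigma_apply]
    exact_mod_cast Finset.single_le_sum (f := fun d ↦ d ^ 11) (fun _ _ ↦ Nat.zero_le _)
      (Nat.mem_divisors_self n (by lia))
  have hpow : 243 * (n : ℝ) ^ 6 ≤ n ^ 11 := by
    calc 243 * (n : ℝ) ^ 6 = 3 ^ 5 * (n : ℝ) ^ 6 := by norm_num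
      _ ≤ (n : ℝ) ^ 5 * (n : ℝ) ^ 6 := by gcongr
      _ = (n : ℝ) ^ 11 := by ring
  have hτ : |c * tau n| ≤ 86 * (65520 / 691) * (2 * n ^ 6) := by
    rw [abs_mul]
    exact mul_le_mul hc (abs_tau_le (by lia)) (abs_nonneg _) (by norm_num)
  have hpos : (0 : ℝ) < n ^ 6 := by positivity
  linarith [neg_abs_le (c * tau n)]

lemma qExpansion_coeff_of_weight_twelve {f : ModularForm 𝒮ℒ 12}
    (hf : (qExpansion 1 f).coeff 0 = 1) {n : ℕ} (hn : n ≠ 0) :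
    (qExpansion 1 f).coeff n = 65520 / 691 * (ArithmeticFunction.sigma 11 n : ℂ) +
      ((qExpansion 1 f).coeff 1 - 65520 / 691) * tau n := by
  obtain ⟨g, hg⟩ := sub_smul_isCuspForm f (E (show 3 ≤ 12 by norm_num))
    (E_qExpansion_coeff_zero _ ⟨6, rfl⟩)
  obtain ⟨c, rfl⟩ := CuspForm.exists_smul_discriminant_of_weight_eq_twelve g
  have hfc : (f : ℍ → ℂ) = E (show 3 ≤ 12 by norm_num) + c • (CuspForm.discriminant : ℍ → ℂ) := by
    ext z
    have := DFunLike.congr_fun hg z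
    rw [hf, one_smul, CuspForm.toModularFormₗ_apply, sub_apply] at this
    rw [Pi.add_apply, ← FunLike.coe_smul, this]
    ring
  have h1 := qExpansion_E_twelve_add_smul_discriminant_coeff c 1
  have h2 := qExpansion_E_twelve_add_smul_discriminant_coeff c n
  rw [← hfc] at h1 h2
  rw [h1, h2, if_neg hn, if_neg one_ne_zero, tau_one]
  simp

/-- A weight 12 form cannot equal `1` on a horizontal strip at the real axis. -/
lemma exists_im_le_and_ne_one (f : ModularForm (Gamma 1) 12) (w : ℍ) :
    ∃ z : ℍ, z.im ≤ w.im ∧ f z ≠ 1 := by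
  by_contra! h
  let z : ℍ := ⟨2 + w.im * Complex.I, by simpa using w.im_pos⟩
  have hre : (z : ℂ).re = 2 := by simp [z]
  have him : z.im = w.im := by rw [← UpperHalfPlane.coe_im]; simp [z]
  have hnorm : 2 ≤ ‖(z : ℂ)‖ := by
    have h2 := abs_re_le_norm (z : ℂ)
    rwa [hre, abs_two] at h2
  have hS : (ModularGroup.S • z).im ≤ w.im := by
    rw [ModularGroup.im_smul_eq_div_normSq, ModularGroup.denom_S, Complex.normSq_eq_norm_sq, him]
    exact div_le_self w.im_pos.le (by nlinarith)
  have heq := SlashInvariantForm.slash_action_eqn_SL'' f (mem_Gamma_one ModularGroup.S) z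
  rw [h _ hS, h z him.le, ModularGroup.denom_S, mul_one] at heq
  have hn := congrArg norm heq
  rw [norm_one, norm_zpow] at hn
  exact (one_lt_zpow₀ (by linarith : (1 : ℝ) < ‖(z : ℂ)‖) (by norm_num : (0 : ℤ) < 12)).ne hn

lemma norm_exp_two_pi_I_mul (n : ℕ) (z : ℍ) :
    ‖Complex.exp (2 * π * Complex.I * (n + 1) * (z : ℂ))‖ =
      Real.exp (-(2 * π * (n + 1) * z.im)) := by
  rw [Complex.norm_exp]
  congr 1
  simp [Complex.mul_re, Complex.mul_im]

lemma summable_of_eq_one_add_tsum {f : ModularForm (Gamma 1) 12} {a : ℕ → ℝ}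
    (hf : ∀ z : ℍ, f z = 1 + ∑' n : ℕ,
      (a (n + 1) : ℂ) * Complex.exp (2 * π * Complex.I * (n + 1) * (z : ℂ))) (w : ℍ) :
    Summable fun n : ℕ ↦
      (a (n + 1) : ℂ) * Complex.exp (2 * π * Complex.I * (n + 1) * (w : ℂ)) := by
  obtain ⟨z, hz, hne⟩ := exists_im_le_and_ne_one f w
  have hs : Summable fun n : ℕ ↦
      (a (n + 1) : ℂ) * Complex.exp (2 * π * Complex.I * (n + 1) * (z : ℂ)) := by
    by_contra hs
    exact hne (by rw [hf z, tsum_eq_zero_of_not_summable hs, add_zero])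
  refine .of_norm_bounded hs.norm fun n ↦ ?_
  rw [norm_mul, norm_mul, norm_exp_two_pi_I_mul, norm_exp_two_pi_I_mul]
  gcongr

lemma qParam_one_pow (n : ℕ) (z : ℍ) : Function.Periodic.qParam 1 (z : ℂ) ^ (n + 1) =
    Complex.exp (2 * π * Complex.I * (n + 1) * (z : ℂ)) := by
  rw [Function.Periodic.qParam, ← Complex.exp_nat_mul]
  congr 1
  push_cast
  ring

lemma qExpansion_coeff_eq_of_eq_one_add_tsum {f : ModularForm (Gamma 1) 12} {a : ℕ → ℝ}
    (hf : ∀ z : ℍ, f z = 1 + ∑' n : ℕ,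
      (a (n + 1) : ℂ) * Complex.exp (2 * π * Complex.I * (n + 1) * (z : ℂ))) (n : ℕ) :
    (qExpansion 1 f).coeff n = if n = 0 then 1 else (a n : ℂ) := by
  let F : ModularForm 𝒮ℒ 12 := f.mcast rfl Gamma_one_coe_eq_SL.symm
  have hF (z : ℍ) : HasSum (fun m ↦ (if m = 0 then 1 else (a m : ℂ)) •
      Function.Periodic.qParam 1 (z : ℂ) ^ m) (F z) := by
    rw [← hasSum_nat_add_iff' 1]
    simpa [qParam_one_pow, F, hf z] using (summable_of_eq_one_add_tsum hf z).hasSum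
  exact (ModularFormClass.qExpansion_coeff_unique one_pos one_mem_strictPeriods_SL hF n).symm

end ModularForm

open ModularForm in
theorem weight_twelve_nonnegativity :
    (∀ (f : ModularForm (Gamma 1) 12) (a : ℕ → ℝ),
      (∀ z : ℍ, f z = 1 + ∑' n : ℕ,
        (a (n + 1) : ℂ) * Complex.exp (2 * π * Complex.I * (n + 1) * (z : ℂ))) →
      0 ≤ a 1 → 0 ≤ a 2 →
      (∀ n, 1 ≤ n → 0 ≤ a n) ∧ (∀ n, 3 ≤ n → 0 < a n)) ∧
    (∃ (g : ModularForm (Gamma 1) 12) (b : ℕ → ℝ),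
      (∀ z : ℍ, g z = 1 + ∑' n : ℕ,
        (b (n + 1) : ℂ) * Complex.exp (2 * π * Complex.I * (n + 1) * (z : ℂ))) ∧
      (∀ n, 1 ≤ n → n ≠ 2 → 0 ≤ b n) ∧ b 2 < 0) := by
  have hσ : ArithmeticFunction.sigma 11 1 = 1 ∧ ArithmeticFunction.sigma 11 2 = 2049 := by decide
  constructor
  · intro f a hf h1 h2
    have hcoeff := qExpansion_coeff_eq_of_eq_one_add_tsum hf
    have ha {n : ℕ} (hn : n ≠ 0) : a n = 65520 / 691 * (ArithmeticFunction.sigma 11 n : ℝ) +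
        (a 1 - 65520 / 691) * tau n := by
      have h := qExpansion_coeff_of_weight_twelve (f := f.mcast rfl Gamma_one_coe_eq_SL.symm)
        (hcoeff 0) hn
      change (qExpansion 1 f).coeff n = _ + ((qExpansion 1 f).coeff 1 - _) * _ at h
      rw [hcoeff, hcoeff, if_neg hn, if_neg one_ne_zero] at h
      apply Complex.ofReal_injective
      push_cast
      exact h
    have hpos (n : ℕ) (hn : 3 ≤ n) : 0 < a n := by
      rw [ha (by lia)]
      refine sigma_add_mul_tau_pos (abs_le.mpr ⟨by linarith, ?_⟩) hn
      rw [ha two_ne_zero, tau_two, hσ.2] at h2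
      norm_num at h2 ⊢
      linarith
    refine ⟨fun n hn ↦ ?_, hpos⟩
    obtain rfl | rfl | hn : n = 1 ∨ n = 2 ∨ 3 ≤ n := by lia
    exacts [h1, h2, (hpos n hn).le]
  · set c : ℝ := 86 * (65520 / 691) with hc
    let g : ModularForm 𝒮ℒ 12 := E (show 3 ≤ 12 by norm_num) +
      (c : ℂ) • CuspForm.toModularFormₗ CuspForm.discriminant
    let b (n : ℕ) : ℝ := 65520 / 691 * (ArithmeticFunction.sigma 11 n : ℝ) + c * tau n
    refine ⟨g.mcast rfl Gamma_one_coe_eq_SL, b, fun z ↦ ?_, fun n hn hn2 ↦ ?_, ?_⟩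
    · have hs := ModularForm.hasSum_qExpansion g one_pos one_mem_strictPeriods_SL z
      rw [← hasSum_nat_add_iff' 1] at hs
      have hcoeff := qExpansion_E_twelve_add_smul_discriminant_coeff c
      change ∀ n, (qExpansion 1 g).coeff n = _ at hcoeff
      simp only [hcoeff, qParam_one_pow, Finset.sum_range_one, tau_zero] at hs
      change g z = _
      rw [← sub_eq_iff_eq_add']
      simpa [b] using hs.tsum_eq.symm
    · obtain rfl | hn : n = 1 ∨ 3 ≤ n := by lia
      · simp only [b, hσ.1, tau_one, hc]
        norm_num
      · exact (sigma_add_mul_tau_pos (abs_of_pos (by positivity)).le hn).le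
    · simp only [b, hσ.2, tau_two, hc]
      norm_num
end

section
/- Let ℓ ≥ 1 and let (T_n)_{n≥1} be a family of closed half-spaces in ℝ^ℓ each of whose boundary hyperplane passes through the origin, such that ⋂_{n≥1} T_n = {0}. Then there is a finite subset B of positive integers with ⋂_{n∈B} T_n = {0}; moreover any intersection ⋂_{n∈B} S_n of closed half-spaces S_n with boundaries parallel to those of T_n (and S_n ⊆ translate of T_n in the corresponding direction, i.e., T_n is the recession cone direction of S_n) is bounded. -/
open RealInnerProductSpace

/-- Compactness of the unit sphere: if the homogeneous half-spaces with inner normals `v n` meet only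
in `0`, then finitely many of them already do so, in a uniform quantitative sense. -/
theorem exists_finset_inner_lt_neg_mul_norm {E : Type*} [NormedAddCommGroup E]
    [InnerProductSpace ℝ E] [FiniteDimensional ℝ E] (v : ℕ → E)
    (hv : ∀ x : E, (∀ n, 0 ≤ ⟪v n, x⟫) → x = 0) :
    ∃ B : Finset ℕ, ∃ ε > 0, ∀ x : E, x ≠ 0 → ∃ n ∈ B, ⟪v n, x⟫ < -(ε * ‖x‖) := by
  have : ProperSpace E := FiniteDimensional.proper ℝ E
  let U : ℕ → Set E := fun k => ⋃ n ∈ Finset.range (k + 1), {x | ⟪v n, x⟫ < -(1 / ((k : ℝ) + 1))}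
  have hU : Monotone U := by
    intro k m hkm x hx
    simp only [U, Set.mem_iUnion, Finset.mem_range, Set.mem_ofPred_eq, exists_prop] at hx ⊢
    obtain ⟨n, hn, hx⟩ := hx
    have := Nat.one_div_le_one_div (α := ℝ) hkm
    exact ⟨n, by omega, by linarith⟩
  obtain ⟨N, hN⟩ := (isCompact_sphere (0 : E) 1).elim_directed_cover U
    (fun k => isOpen_biUnion fun n _ => isOpen_lt (by fun_prop) continuous_const)
    (by
      intro x hx
      obtain ⟨n, hn⟩ : ∃ n, ⟪v n, x⟫ < 0 := by
        by_contra! h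
        simp [hv x h] at hx
      obtain ⟨m, hm⟩ := exists_nat_one_div_lt (neg_pos.2 hn)
      have := Nat.one_div_le_one_div (α := ℝ) (le_max_right n m)
      simp only [U, Set.mem_iUnion, Finset.mem_range, Set.mem_ofPred_eq, exists_prop]
      exact ⟨max n m, n, by omega, by linarith⟩)
    hU.directed_le
  refine ⟨Finset.range (N + 1), 1 / ((N : ℝ) + 1), Nat.one_div_pos_of_nat, fun x hx => ?_⟩
  have hx' : 0 < ‖x‖ := norm_pos_iff.2 hx
  have hmem := hN (show ‖x‖⁻¹ • x ∈ Metric.sphere (0 : E) 1 by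
    simp [norm_smul, hx'.ne'])
  simp only [U, Set.mem_iUnion, Set.mem_ofPred_eq, exists_prop, inner_smul_right] at hmem
  obtain ⟨n, hn, h⟩ := hmem
  refine ⟨n, hn, ?_⟩
  rw [inv_mul_lt_iff₀ hx'] at h
  linarith

theorem finite_halfspace_intersection (ℓ : ℕ) (hℓ : 1 ≤ ℓ)
    (v : ℕ → EuclideanSpace ℝ (Fin ℓ)) (hv : ∀ n, v n ≠ 0)
    (hT : (⋂ n : ℕ, {x : EuclideanSpace ℝ (Fin ℓ) | 0 ≤ ⟪v n, x⟫}) = {0}) :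
    ∃ B : Finset ℕ,
      (⋂ n ∈ B, {x : EuclideanSpace ℝ (Fin ℓ) | 0 ≤ ⟪v n, x⟫}) = {0} ∧
      ∀ c : ℕ → ℝ, Bornology.IsBounded
        (⋂ n ∈ B, {x : EuclideanSpace ℝ (Fin ℓ) | c n ≤ ⟪v n, x⟫}) := by
  obtain ⟨B, ε, hε, h⟩ := exists_finset_inner_lt_neg_mul_norm v fun x hx => by
    have hmem : x ∈ ⋂ n : ℕ, {x : EuclideanSpace ℝ (Fin ℓ) | 0 ≤ ⟪v n, x⟫} := Set.mem_iInter.2 hx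
    rwa [hT] at hmem
  refine ⟨B, ?_, fun c => ?_⟩
  · refine Set.Subset.antisymm (fun x hx => ?_) (by simp)
    by_contra hne
    obtain ⟨n, hn, hlt⟩ := h x hne
    have hle : 0 ≤ ⟪v n, x⟫ := Set.mem_iInter₂.1 hx n hn
    have : 0 ≤ ε * ‖x‖ := by positivity
    linarith
  · refine isBounded_iff_forall_norm_le.2 ⟨(∑ n ∈ B, |c n|) / ε, fun x hx => ?_⟩
    rw [le_div_iff₀' hε]
    have hsum : 0 ≤ ∑ n ∈ B, |c n| := Finset.sum_nonneg fun _ _ => abs_nonneg _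
    rcases eq_or_ne x 0 with rfl | hne
    · simpa using hsum
    · obtain ⟨n, hn, hlt⟩ := h x hne
      have hle : c n ≤ ⟪v n, x⟫ := Set.mem_iInter₂.1 hx n hn
      have := Finset.single_le_sum (f := fun n => |c n|) (fun _ _ => abs_nonneg _) hn
      have := neg_abs_le (c n)
      linarith
end
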